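/- Let G be a connected finite simple graph with at least one pendant vertex, consisting of n ≥ 4 edges, and let p > 1. Then λ_{1,p}(G) = λ_{1,p}(T_{n,3}) if and only if G is isomorphic to the tadpole graph T_{n,3}. -/

import Mathlib

attribute [local instance] Classical.propDecidable

open Finset

/-- The degree of a vertex `x` in a finite simple graph `G`. -/
noncomputable def deg {V : Type*} [Fintype V] (G : SimpleGraph V) (x : V) : ℕ :=
  (Finset.univ.filter (fun y => G.Adj x y)).card

/-- The `p`-energy `‖df‖_{p,G}^p = Σ_{{x,y} ∈ E(G)} |f x - f y|^p`
(each unordered edge counted once, i.e. half the double sum). -/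
noncomputable def energy {V : Type*} [Fintype V] (G : SimpleGraph V) (p : ℝ) (f : V → ℝ) : ℝ :=
  (∑ x : V, ∑ y : V, if G.Adj x y then |f x - f y| ^ p else 0) / 2

/-- The weighted `p`-norm `‖f‖_{p,G}^p = Σ_x |f x|^p · deg x`. -/
noncomputable def pnorm {V : Type*} [Fintype V] (G : SimpleGraph V) (p : ℝ) (f : V → ℝ) : ℝ :=
  ∑ x : V, |f x| ^ p * (deg G x : ℝ)

/-- The `p`-Rayleigh quotient `R_{p,G}[f]`. -/
noncomputable def rayleigh {V : Type*} [Fintype V] (G : SimpleGraph V) (p : ℝ) (f : V → ℝ) : ℝ :=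
  energy G p f / pnorm G p f

/-- The first `p`-Dirichlet eigenvalue `λ_{1,p}(G)`: the infimum of Rayleigh quotients of
nonzero functions vanishing on the boundary `B(G)` (the set of pendant vertices). -/
noncomputable def lambda1 {V : Type*} [Fintype V] (G : SimpleGraph V) (p : ℝ) : ℝ :=
  sInf { r : ℝ | ∃ f : V → ℝ, (∀ x : V, deg G x = 1 → f x = 0) ∧ f ≠ 0 ∧ r = rayleigh G p f }

/-- The number of edges with exactly one endpoint in `U`. -/
noncomputable def cutCard {V : Type*} [Fintype V] (G : SimpleGraph V) (U : Finset V) : ℕ :=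
  ∑ x ∈ U, (Finset.univ.filter (fun y => G.Adj x y ∧ y ∉ U)).card

/-- The Dirichlet Cheeger constant `h_D(G)`. -/
noncomputable def cheeger {V : Type*} [Fintype V] (G : SimpleGraph V) : ℝ :=
  sInf { r : ℝ | ∃ U : Finset V, U.Nonempty ∧ (∀ x ∈ U, deg G x ≠ 1) ∧
    r = (cutCard G U : ℝ) / ∑ x ∈ U, (deg G x : ℝ) }

/-- The tadpole graph `T_{n,i}` on vertices `0, …, n-1` (vertex `k-1` representing `t_k`):
edges between consecutive vertices together with the edge `t_1 ∼ t_i`. -/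
def tadpole (n i : ℕ) : SimpleGraph (Fin n) :=
  SimpleGraph.fromRel (fun a b => b.val = a.val + 1 ∨ (a.val = 0 ∧ b.val = i - 1))

/-- The path graph on `n` vertices. -/
def pathG (n : ℕ) : SimpleGraph (Fin n) :=
  SimpleGraph.fromRel (fun a b => b.val = a.val + 1)

section aux
variable {V : Type*} [Fintype V]

theorem dsum_eq (G : SimpleGraph V) (F : Sym2 V → ℝ) :
    (∑ x : V, ∑ y : V, if G.Adj x y then F s(x, y) else 0) = 2 * ∑ e ∈ G.edgeFinset, F e := by
  rw [← Fintype.sum_prod_type' (f := fun x y => if G.Adj x y then F s(x, y) else 0)]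
  rw [← Finset.sum_filter]
  rw [← Finset.sum_fiberwise_of_maps_to (t := G.edgeFinset) (g := fun q : V × V => s(q.1, q.2))]
  · rw [Finset.mul_sum]
    refine Finset.sum_congr rfl ?_
    intro e he
    induction e using Sym2.ind with
    | _ a b =>
      have hab : G.Adj a b := by simpa using he
      have : (Finset.univ.filter (fun q : V × V => G.Adj q.1 q.2)).filter
          (fun q => s(q.1, q.2) = s(a, b)) = {(a, b), (b, a)} := by
        ext ⟨c, d⟩
        simp only [Finset.mem_filter, Finset.mem_univ, true_and, Finset.mem_insert,
          Finset.mem_singleton, Sym2.eq_iff, Prod.mk.injEq]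
        constructor
        · rintro ⟨_, h⟩; exact h
        · rintro (⟨rfl, rfl⟩ | ⟨rfl, rfl⟩)
          · exact ⟨hab, Or.inl ⟨rfl, rfl⟩⟩
          · exact ⟨hab.symm, Or.inr ⟨rfl, rfl⟩⟩
      rw [this, Finset.sum_pair]
      · rw [Sym2.eq_swap (a := b)]; ring
      · intro h
        exact hab.ne (Prod.mk.inj h).1
  · rintro ⟨a, b⟩ h
    simpa using h

/-- edge contribution to the energy -/
noncomputable def eF (p : ℝ) (f : V → ℝ) : Sym2 V → ℝ :=
  Sym2.lift ⟨fun x y => |f x - f y| ^ p, fun x y => by beta_reduce; rw [abs_sub_comm]⟩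

/-- edge contribution to the norm -/
noncomputable def nF (p : ℝ) (f : V → ℝ) : Sym2 V → ℝ :=
  Sym2.lift ⟨fun x y => |f x| ^ p + |f y| ^ p, fun x y => by beta_reduce; rw [add_comm]⟩

theorem energy_eq (G : SimpleGraph V) (p : ℝ) (f : V → ℝ) :
    energy G p f = ∑ e ∈ G.edgeFinset, eF p f e := by
  have := dsum_eq G (eF p f)
  unfold energy
  simp only [eF, Sym2.lift_mk] at this ⊢
  rw [this]; ring

theorem pnorm_eq' (G : SimpleGraph V) (p : ℝ) (f : V → ℝ) :
    pnorm G p f = (∑ x : V, ∑ y : V, if G.Adj x y then |f x| ^ p + |f y| ^ p else 0) / 2 := by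
  have h1 : pnorm G p f = ∑ x : V, ∑ y : V, if G.Adj x y then |f x| ^ p else 0 := by
    unfold pnorm deg
    refine Finset.sum_congr rfl fun x _ => ?_
    rw [← Finset.sum_filter, Finset.sum_const, nsmul_eq_mul, mul_comm]
  have h2 : pnorm G p f = ∑ x : V, ∑ y : V, if G.Adj x y then |f y| ^ p else 0 := by
    rw [h1, Finset.sum_comm]
    refine Finset.sum_congr rfl fun x _ => Finset.sum_congr rfl fun y _ => ?_
    simp only [G.adj_comm]
  have h3 : (∑ x : V, ∑ y : V, if G.Adj x y then |f x| ^ p + |f y| ^ p else 0)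
      = pnorm G p f + pnorm G p f := by
    nth_rewrite 1 [h1]
    rw [h2, ← Finset.sum_add_distrib]
    refine Finset.sum_congr rfl fun x _ => ?_
    rw [← Finset.sum_add_distrib]
    refine Finset.sum_congr rfl fun y _ => ?_
    split_ifs <;> simp
  rw [h3]; ring

theorem pnorm_eq (G : SimpleGraph V) (p : ℝ) (f : V → ℝ) :
    pnorm G p f = ∑ e ∈ G.edgeFinset, nF p f e := by
  have := dsum_eq G (nF p f)
  rw [pnorm_eq']
  simp only [nF, Sym2.lift_mk] at this ⊢
  rw [this]; ring

theorem energy_nonneg (G : SimpleGraph V) (p : ℝ) (f : V → ℝ) : 0 ≤ energy G p f := by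
  unfold energy
  refine div_nonneg (Finset.sum_nonneg fun x _ => Finset.sum_nonneg fun y _ => ?_) (by norm_num)
  split_ifs <;> positivity

theorem pnorm_nonneg (G : SimpleGraph V) (p : ℝ) (f : V → ℝ) : 0 ≤ pnorm G p f :=
  Finset.sum_nonneg fun x _ => by positivity

theorem pnorm_pos (G : SimpleGraph V) (p : ℝ) (f : V → ℝ) (hd : ∀ x, 0 < deg G x)
    (hf : f ≠ 0) : 0 < pnorm G p f := by
  obtain ⟨x, hx⟩ := Function.ne_iff.mp hf
  refine Finset.sum_pos' (fun x _ => by positivity) ⟨x, Finset.mem_univ _, ?_⟩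
  have := hd x
  have h2 : 0 < |f x| := abs_pos.mpr hx
  positivity

theorem lambda1_le (G : SimpleGraph V) (p : ℝ) (f : V → ℝ)
    (h0 : ∀ x, deg G x = 1 → f x = 0) (hf : f ≠ 0) : lambda1 G p ≤ rayleigh G p f := by
  refine csInf_le ⟨0, ?_⟩ ⟨f, h0, hf, rfl⟩
  rintro r ⟨g, _, _, rfl⟩
  exact div_nonneg (energy_nonneg _ _ _) (pnorm_nonneg _ _ _)

theorem lambda1_iso {W : Type*} [Fintype W] (G : SimpleGraph V) (H : SimpleGraph W) (p : ℝ)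
    (φ : G ≃g H) : lambda1 G p = lambda1 H p := by
  have hdeg : ∀ x, deg H (φ x) = deg G x := by
    intro x
    unfold deg
    symm
    refine Finset.card_bij (fun y _ => φ y) ?_ ?_ ?_
    · intro y hy
      simp only [Finset.mem_filter, Finset.mem_univ, true_and] at hy ⊢
      exact φ.map_rel_iff.mpr hy
    · intro a _ b _ h; exact φ.injective h
    · intro b hb
      obtain ⟨y, rfl⟩ := φ.surjective b
      refine ⟨y, ?_, rfl⟩
      simp only [Finset.mem_filter, Finset.mem_univ, true_and] at hb ⊢
      exact φ.map_rel_iff.mp hb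
  have hE : ∀ f : W → ℝ, energy G p (fun x => f (φ x)) = energy H p f := by
    intro f
    unfold energy
    congr 1
    refine Fintype.sum_equiv φ.toEquiv _ _ fun x => Fintype.sum_equiv φ.toEquiv _ _ fun y => ?_
    have : H.Adj (φ.toEquiv x) (φ.toEquiv y) ↔ G.Adj x y := φ.map_rel_iff
    simp only [this]
    rfl
  have hN : ∀ f : W → ℝ, pnorm G p (fun x => f (φ x)) = pnorm H p f := by
    intro f
    unfold pnorm
    refine Fintype.sum_equiv φ.toEquiv _ _ fun x => ?_
    rw [← hdeg]; rfl
  unfold lambda1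
  congr 1
  ext r
  constructor
  · rintro ⟨f, h0, hf, rfl⟩
    have key : (fun x => (fun w => f (φ.symm w)) (φ x)) = f := by
      funext x; simp
    refine ⟨fun w => f (φ.symm w), ?_, ?_, ?_⟩
    · intro w hw
      apply h0
      rw [← hdeg]; simpa using hw
    · intro h
      apply hf
      rw [← key, h]; rfl
    · unfold rayleigh
      rw [← hE, ← hN, key]
  · rintro ⟨f, h0, hf, rfl⟩
    refine ⟨fun x => f (φ x), ?_, ?_, ?_⟩
    · intro x hx
      apply h0
      rw [hdeg]; exact hx
    · intro h
      apply hf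
      funext w
      obtain ⟨x, rfl⟩ := φ.surjective w
      exact congrFun h x
    · unfold rayleigh
      rw [← hE, ← hN]

theorem energy_smul (G : SimpleGraph V) (p : ℝ) (f : V → ℝ) (c : ℝ) :
    energy G p (fun x => c * f x) = |c| ^ p * energy G p f := by
  unfold energy
  rw [← mul_div_assoc, Finset.mul_sum]
  congr 1
  refine Finset.sum_congr rfl fun x _ => ?_
  rw [Finset.mul_sum]
  refine Finset.sum_congr rfl fun y _ => ?_
  rw [← mul_sub, abs_mul, Real.mul_rpow (abs_nonneg _) (abs_nonneg _)]
  split_ifs <;> simp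

theorem pnorm_smul (G : SimpleGraph V) (p : ℝ) (f : V → ℝ) (c : ℝ) :
    pnorm G p (fun x => c * f x) = |c| ^ p * pnorm G p f := by
  unfold pnorm
  rw [Finset.mul_sum]
  refine Finset.sum_congr rfl fun x _ => ?_
  rw [abs_mul, Real.mul_rpow (abs_nonneg _) (abs_nonneg _)]
  ring

theorem exists_min (G : SimpleGraph V) (p : ℝ) (hp : 1 < p) (hd : ∀ x, 0 < deg G x)
    (hi : ∃ x, deg G x ≠ 1) :
    ∃ f : V → ℝ, (∀ x, 0 ≤ f x) ∧ (∀ x, f x ≤ 1) ∧ (∃ v, f v = 1) ∧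
      (∀ x, deg G x = 1 → f x = 0) ∧ lambda1 G p = rayleigh G p f := by
  have hp0 : 0 ≤ p := by linarith
  let K : Set (V → ℝ) := Metric.sphere 0 1 ∩ {f | ∀ x, deg G x = 1 → f x = 0}
  have hK : IsCompact K := by
    refine (isCompact_sphere _ _).inter_right ?_
    have : {f : V → ℝ | ∀ x, deg G x = 1 → f x = 0} = ⋂ x, {f | deg G x = 1 → f x = 0} := by
      ext f; simp
    rw [this]
    refine isClosed_iInter fun x => ?_
    by_cases h : deg G x = 1
    · simp only [h, true_imp_iff]
      exact isClosed_eq (continuous_apply x) continuous_const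
    · simp [h]
  have hne : K.Nonempty := by
    obtain ⟨x, hx⟩ := hi
    refine ⟨Pi.single x 1, ?_, ?_⟩
    · simp [Pi.norm_single]
    · intro y hy
      have : y ≠ x := by rintro rfl; exact hx hy
      simp [this]
  have hK0 : ∀ f ∈ K, f ≠ 0 := by
    rintro f hf rfl
    simpa using hf.1
  have hcont : ContinuousOn (rayleigh G p) K := by
    refine ContinuousOn.div ?_ ?_ fun f hf => (pnorm_pos G p f hd (hK0 f hf)).ne'
    · refine Continuous.continuousOn ?_
      unfold energy
      refine Continuous.div_const (continuous_finsetSum _ fun x _ =>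
        continuous_finsetSum _ fun y _ => ?_) _
      split_ifs
      · exact Continuous.rpow_const (by fun_prop) fun _ => Or.inr hp0
      · exact continuous_const
    · refine Continuous.continuousOn ?_
      unfold pnorm
      refine continuous_finsetSum _ fun x _ => ?_
      exact (Continuous.rpow_const (by fun_prop) fun _ => Or.inr hp0).mul continuous_const
  obtain ⟨f, hfK, hmin⟩ := hK.exists_isMinOn hne hcont
  have hfn : ‖f‖ = 1 := by simpa using hfK.1
  have hlow : rayleigh G p f ≤ lambda1 G p := by
    refine le_csInf ⟨_, f, hfK.2, hK0 f hfK, rfl⟩ ?_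
    rintro r ⟨g, hg0, hg, rfl⟩
    have hgn : ‖g‖ ≠ 0 := by simpa using hg
    have hm : (fun x => ‖g‖⁻¹ * g x) ∈ K := by
      constructor
      · have : (fun x => ‖g‖⁻¹ * g x) = ‖g‖⁻¹ • g := rfl
        rw [this]
        simp [norm_smul, hgn]
      · intro x hx
        simp [hg0 x hx]
    have h1 := hmin hm
    have h2 : rayleigh G p (fun x => ‖g‖⁻¹ * g x) = rayleigh G p g := by
      unfold rayleigh
      rw [energy_smul, pnorm_smul]
      have : 0 < |‖g‖⁻¹| := by positivity
      have : 0 < |‖g‖⁻¹| ^ p := by positivity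
      rw [mul_div_mul_left _ _ this.ne']
    have h3 : rayleigh G p f ≤ rayleigh G p (fun x => ‖g‖⁻¹ * g x) := h1
    rwa [h2] at h3
  have habs0 : ∀ x, deg G x = 1 → |f x| = 0 := fun x hx => by simp [hfK.2 x hx]
  have habsne : (fun x => |f x|) ≠ 0 := by
    intro h
    apply hK0 f hfK
    funext x
    simpa using congrFun h x
  have habs : rayleigh G p (fun x => |f x|) ≤ rayleigh G p f := by
    unfold rayleigh
    have : pnorm G p (fun x => |f x|) = pnorm G p f := by
      unfold pnorm; simp
    rw [this]
    refine div_le_div_of_nonneg_right ?_ (pnorm_nonneg _ _ _)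
    unfold energy
    refine div_le_div_of_nonneg_right ?_ (by norm_num)
    refine Finset.sum_le_sum fun x _ => Finset.sum_le_sum fun y _ => ?_
    split_ifs
    · exact Real.rpow_le_rpow (abs_nonneg _) (abs_abs_sub_abs_le _ _) hp0
    · exact le_rfl
  have hle : ∀ x, |f x| ≤ 1 := fun x => by
    rw [← hfn]; exact norm_le_pi_norm f x
  refine ⟨fun x => |f x|, fun x => abs_nonneg _, hle, ?_, habs0, ?_⟩
  · by_contra hcon
    push Not at hcon
    have : ‖f‖ < 1 := by
      rw [pi_norm_lt_iff one_pos]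
      intro x
      exact lt_of_le_of_ne (hle x) (hcon x)
    linarith
  · exact le_antisymm (lambda1_le G p _ habs0 habsne) (habs.trans hlow)

end aux
theorem tadpole_adj (m : ℕ) (a b : Fin (m + 4)) : (tadpole (m + 4) 3).Adj a b ↔
    ((b.val = a.val + 1 ∨ (a.val = 0 ∧ b.val = 2)) ∨
      (a.val = b.val + 1 ∨ (b.val = 0 ∧ a.val = 2))) := by
  unfold tadpole
  rw [SimpleGraph.fromRel_adj]
  constructor
  · rintro ⟨_, h⟩; simpa using h
  · intro h
    refine ⟨?_, by simpa using h⟩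
    rintro rfl
    omega

theorem tadpole_dsum (m : ℕ) (H : ℕ → ℕ → ℝ) (hH : ∀ a b, H a b = H b a) :
    (∑ x : Fin (m + 4), ∑ y : Fin (m + 4),
      if (tadpole (m + 4) 3).Adj x y then H x.val y.val else 0) / 2 =
    H 0 2 + ∑ a ∈ Finset.range (m + 3), H a (a + 1) := by
  let r : ℕ → ℕ → Prop := fun a b => b = a + 1 ∨ (a = 0 ∧ b = 2)
  have h1 : ∀ x y : Fin (m + 4), (if (tadpole (m + 4) 3).Adj x y then H x.val y.val else 0) =
      (if r x.val y.val then H x.val y.val else 0) +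
      (if r y.val x.val then H y.val x.val else 0) := by
    intro x y
    have hx : ((tadpole (m + 4) 3).Adj x y) ↔ (r x.val y.val ∨ r y.val x.val) :=
      tadpole_adj m x y
    rw [hH y.val x.val]
    by_cases ha : r x.val y.val
    · have hb : ¬ r y.val x.val := by
        simp only [r] at ha ⊢; omega
      simp [hx, ha, hb]
    · simp [hx, ha]
  have h2 : ∀ x y : Fin (m + 4), (if r x.val y.val then H x.val y.val else 0) =
      (if y.val = x.val + 1 then H x.val (x.val + 1) else 0) +
      (if x.val = 0 then (if y.val = 2 then H 0 2 else 0) else 0) := by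
    intro x y
    simp only [r]
    by_cases ha : y.val = x.val + 1
    · have hb : ¬ (x.val = 0 ∧ y.val = 2) := by omega
      by_cases hc : x.val = 0
      · have : y.val ≠ 2 := by omega
        simp [ha, hc]
      · simp [ha, hc]
    · by_cases hc : x.val = 0
      · by_cases hd : y.val = 2
        · simp [hc, hd]
        · have hy : y.val ≠ 1 := by omega
          simp [hc, hd, hy]
      · simp [ha, hc]
  have h3 : (∑ x : Fin (m + 4), ∑ y : Fin (m + 4), if r x.val y.val then H x.val y.val else 0) =
      H 0 2 + ∑ a ∈ Finset.range (m + 3), H a (a + 1) := by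
    simp only [h2, Finset.sum_add_distrib]
    rw [add_comm]
    congr 1
    · have e : ∀ x : Fin (m + 4), (∑ y : Fin (m + 4),
          if x.val = 0 then (if y.val = 2 then H 0 2 else 0) else 0) =
          if x.val = 0 then H 0 2 else 0 := by
        intro x
        rw [Fin.sum_univ_eq_sum_range
          (fun y => if x.val = 0 then (if y = 2 then H 0 2 else 0) else 0) (m + 4)]
        split_ifs
        · rw [Finset.sum_ite_eq']; simp
        · simp
      simp only [e]
      rw [Fin.sum_univ_eq_sum_range (fun x => if x = 0 then H 0 2 else 0) (m + 4),
        Finset.sum_ite_eq']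
      simp
    · have e : ∀ x : Fin (m + 4), (∑ y : Fin (m + 4),
          if y.val = x.val + 1 then H x.val (x.val + 1) else 0) =
          if x.val + 1 < m + 4 then H x.val (x.val + 1) else 0 := by
        intro x
        rw [Fin.sum_univ_eq_sum_range
          (fun y => if y = x.val + 1 then H x.val (x.val + 1) else 0) (m + 4),
          Finset.sum_ite_eq']
        simp
      simp only [e]
      rw [Fin.sum_univ_eq_sum_range (fun x => if x + 1 < m + 4 then H x (x + 1) else 0) (m + 4),
        Finset.sum_range_succ]
      simp only [lt_irrefl, if_false, add_zero]
      refine Finset.sum_congr rfl fun a ha => ?_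
      rw [if_pos]
      have := Finset.mem_range.mp ha
      omega
  simp only [h1, Finset.sum_add_distrib]
  rw [h3]
  rw [Finset.sum_comm, h3]
  ring

/-- test sequence on the tadpole -/
noncomputable def tg (m : ℕ) (h : ℕ → ℝ) (b : ℝ) (j : ℕ) : ℝ := if j < 2 then b else h (m + 3 - j)

theorem tadpole_sum (m : ℕ) (h : ℕ → ℝ) (b : ℝ) (Q : ℝ → ℝ → ℝ) (hQ : ∀ s t, Q s t = Q t s) :
    (∑ x : Fin (m + 4), ∑ y : Fin (m + 4),
      if (tadpole (m + 4) 3).Adj x y then Q (tg m h b x.val) (tg m h b y.val) else 0) / 2 =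
    2 * Q b (h (m + 1)) + Q b b + ∑ i ∈ Finset.range (m + 1), Q (h i) (h (i + 1)) := by
  rw [tadpole_dsum m (fun x y => Q (tg m h b x) (tg m h b y)) (fun _ _ => hQ _ _)]
  rw [Finset.sum_range_succ', Finset.sum_range_succ']
  have : ∑ i ∈ Finset.range (m + 1), Q (h i) (h (i + 1)) = ∑ i ∈ Finset.range (m + 1),
      Q (tg m h b (i + 1 + 1)) (tg m h b (i + 1 + 1 + 1)) := by
    rw [← Finset.sum_range_reflect]
    refine Finset.sum_congr rfl fun i hi => ?_
    have := Finset.mem_range.mp hi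
    unfold tg
    rw [if_neg (by omega), if_neg (by omega), hQ]
    have e1 : m + 1 - 1 - i + 1 = m + 3 - (i + 1 + 1) := by omega
    have e2 : m + 1 - 1 - i = m + 3 - (i + 1 + 1 + 1) := by omega
    rw [← e1, ← e2]
  rw [this]
  simp [tg]
  ring

theorem two_le_deg {V : Type*} [Fintype V] (G : SimpleGraph V) (x a b : V) (hab : a ≠ b)
    (ha : G.Adj x a) (hb : G.Adj x b) : 2 ≤ deg G x := by
  unfold deg
  rw [← Nat.lt_iff_add_one_le, Finset.one_lt_card]
  exact ⟨a, by simpa using ha, b, by simpa using hb, hab⟩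

theorem tadpole_le (m : ℕ) (p : ℝ) (h : ℕ → ℝ) (b : ℝ) (h0 : h 0 = 0) (hb : 0 < b) :
    lambda1 (tadpole (m + 4) 3) p *
      (2 * (|b| ^ p + |h (m + 1)| ^ p) + (|b| ^ p + |b| ^ p) +
        ∑ i ∈ Finset.range (m + 1), (|h i| ^ p + |h (i + 1)| ^ p)) ≤
      2 * |b - h (m + 1)| ^ p + |b - b| ^ p +
        ∑ i ∈ Finset.range (m + 1), |h i - h (i + 1)| ^ p := by
  have hE := tadpole_sum m h b (fun s t => |s - t| ^ p) (fun s t => by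
    beta_reduce; rw [abs_sub_comm])
  have hN := tadpole_sum m h b (fun s t => |s| ^ p + |t| ^ p) (fun s t => by
    beta_reduce; rw [add_comm])
  have hl := lambda1_le (tadpole (m + 4) 3) p (fun x => tg m h b x.val) ?_ ?_
  · have hE' : energy (tadpole (m + 4) 3) p (fun x => tg m h b x.val) = _ := hE
    have hN' := (pnorm_eq' (tadpole (m + 4) 3) p (fun x => tg m h b x.val)).trans hN
    unfold rayleigh at hl
    rw [hE', hN'] at hl
    refine (le_div_iff₀ ?_).mp hl
    have : 0 < |b| ^ p := Real.rpow_pos_of_pos (abs_pos.mpr hb.ne') _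
    positivity
  · intro x hx
    by_cases hlast : x.val = m + 3
    · simp [tg, hlast, h0]
    · exfalso
      have hlt : x.val < m + 4 := x.isLt
      have : 2 ≤ deg (tadpole (m + 4) 3) x := by
        by_cases hx0 : x.val = 0
        · refine two_le_deg _ x ⟨1, by omega⟩ ⟨2, by omega⟩ (by simp) ?_ ?_
          · rw [tadpole_adj]; clear hx; dsimp only; omega
          · rw [tadpole_adj]; clear hx; dsimp only; omega
        · refine two_le_deg _ x ⟨x.val + 1, by omega⟩ ⟨x.val - 1, by omega⟩ ?_ ?_ ?_
          · rw [Ne, Fin.mk.injEq]; omega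
          · rw [tadpole_adj]; clear hx; dsimp only; omega
          · rw [tadpole_adj]; clear hx; dsimp only; omega
      omega
  · intro hz
    have := congrFun hz ⟨0, by omega⟩
    simp [tg] at this
    exact hb.ne' this

/-- rigidity core: a test sequence that is constant at the head of the tadpole is not optimal -/
theorem tadpole_strict (m : ℕ) (p : ℝ) (hp : 1 < p) (h : ℕ → ℝ) (h0 : h 0 = 0)
    (h1 : h (m + 1) = 1) (A E N : ℝ) (hA : 0 < A) (hAE : A * N = E)
    (hT : A = lambda1 (tadpole (m + 4) 3) p)
    (hE : ∑ i ∈ Finset.range (m + 1), |h i - h (i + 1)| ^ p ≤ E)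
    (hN : N ≤ 6 + ∑ i ∈ Finset.range (m + 1), (|h i| ^ p + |h (i + 1)| ^ p)) : False := by
  obtain ⟨ε, he, hpow⟩ : ∃ ε : ℝ, 0 < ε ∧ ε ^ p = A * ε := by
    refine ⟨A ^ (1 / (p - 1)), by positivity, ?_⟩
    have hp1 : p - 1 ≠ 0 := by linarith
    have : p = (p - 1) + 1 := by ring
    nth_rewrite 2 [this]
    rw [Real.rpow_add (by positivity), Real.rpow_one, ← Real.rpow_mul hA.le,
      one_div_mul_cancel hp1, Real.rpow_one]
  have key := tadpole_le m p h (1 + ε) h0 (by linarith)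
  rw [← hT, h1] at key
  have hb : 1 + ε ≤ |1 + ε| ^ p := by
    rw [abs_of_pos (by linarith)]
    calc 1 + ε = (1 + ε) ^ (1 : ℝ) := by simp
      _ ≤ _ := Real.rpow_le_rpow_of_exponent_le (by linarith) hp.le
  have z : |1 + ε - (1 + ε)| ^ p = 0 := by
    simp [Real.zero_rpow (by linarith : p ≠ 0)]
  have z2 : |1 + ε - 1| ^ p = A * ε := by
    rw [← hpow, add_sub_cancel_left, abs_of_pos he]
  rw [z, z2] at key
  simp only [abs_one, Real.one_rpow] at key
  set S := ∑ i ∈ Finset.range (m + 1), (|h i| ^ p + |h (i + 1)| ^ p)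
  set X := |1 + ε| ^ p
  have k1 : A * (6 + S + 4 * ε) ≤ A * (2 * (X + 1) + (X + X) + S) :=
    mul_le_mul_of_nonneg_left (by linarith) hA.le
  have k2 : A * N ≤ A * (6 + S) := mul_le_mul_of_nonneg_left hN hA.le
  have : 0 < A * ε := by positivity
  nlinarith
section aux2
variable {V : Type*} [Fintype V]

theorem exists_other (G : SimpleGraph V) (x a : V) (h : deg G x ≠ 1) (ha : G.Adj x a) :
    ∃ b, b ≠ a ∧ G.Adj x b := by
  by_contra hcon
  push Not at hcon
  apply h
  unfold deg
  rw [Finset.card_eq_one]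
  refine ⟨a, ?_⟩
  ext y
  simp only [Finset.mem_filter, Finset.mem_univ, true_and, Finset.mem_singleton]
  constructor
  · intro hy
    by_contra hne
    exact hcon y hne hy
  · rintro rfl; exact ha

theorem exists_dist (G : SimpleGraph V) (hconn : G.Connected) (hpend : ∃ x : V, deg G x = 1) :
    ∃ d : V → ℕ, (∀ z, d z = 0 ↔ deg G z = 1) ∧ (∀ z z', G.Adj z z' → d z ≤ d z' + 1) ∧
      (∀ z m, d z = m + 1 → ∃ z', G.Adj z z' ∧ d z' = m) := by
  let S : V → Set ℕ := fun z => {m | ∃ b, deg G b = 1 ∧ ∃ w : G.Walk z b, w.length = m}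
  have hS : ∀ z, (S z).Nonempty := by
    intro z
    obtain ⟨b, hb⟩ := hpend
    obtain ⟨w⟩ := hconn.preconnected z b
    exact ⟨w.length, b, hb, w, rfl⟩
  have hle : ∀ z z', G.Adj z z' → sInf (S z) ≤ sInf (S z') + 1 := by
    intro z z' hz
    obtain ⟨b, hb, w, hw⟩ := Nat.sInf_mem (hS z')
    refine Nat.sInf_le ⟨b, hb, SimpleGraph.Walk.cons hz w, ?_⟩
    simp [hw]
  refine ⟨fun z => sInf (S z), ?_, hle, ?_⟩
  · intro z
    constructor
    · intro h
      obtain ⟨b, hb, w, hw⟩ := Nat.sInf_mem (hS z)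
      change sInf (S z) = 0 at h
      rw [h] at hw
      rw [SimpleGraph.Walk.eq_of_length_eq_zero hw]
      exact hb
    · intro h
      exact Nat.le_zero.mp (Nat.sInf_le ⟨z, h, SimpleGraph.Walk.nil, rfl⟩)
  · intro z m h
    obtain ⟨b, hb, w, hw⟩ := Nat.sInf_mem (hS z)
    change sInf (S z) = m + 1 at h
    rw [h] at hw
    cases w with
    | nil => simp at hw
    | @cons _ z' _ hz w' =>
      refine ⟨z', hz, ?_⟩
      have h1 := hle z z' hz
      have h2 : sInf (S z') ≤ m := Nat.sInf_le ⟨b, hb, w', by simpa using hw⟩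
      change sInf (S z') = m
      omega

theorem exists_path (G : SimpleGraph V) (d : V → ℕ)
    (hd : ∀ z m, d z = m + 1 → ∃ z', G.Adj z z' ∧ d z' = m) :
    ∀ k z, d z = k → ∃ x : ℕ → V, x k = z ∧ (∀ i ≤ k, d (x i) = i) ∧
      ∀ i < k, G.Adj (x i) (x (i + 1)) := by
  intro k
  induction k with
  | zero =>
    intro z hz
    refine ⟨fun _ => z, rfl, ?_, ?_⟩
    · intro i hi
      obtain rfl : i = 0 := by omega
      exact hz
    · intro i hi; omega
  | succ k ih =>
    intro z hz
    obtain ⟨z', hz', hdz'⟩ := hd z k hz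
    obtain ⟨x, hxk, hxd, hxa⟩ := ih z' hdz'
    refine ⟨fun i => if i ≤ k then x i else z, by simp, ?_, ?_⟩
    · intro i hi
      by_cases h : i ≤ k
      · simp [h, hxd i h]
      · obtain rfl : i = k + 1 := by omega
        simp [hz]
    · intro i hi
      by_cases h : i + 1 ≤ k
      · have : i ≤ k := by omega
        simp only [h, this, if_true]
        exact hxa i (by omega)
      · obtain rfl : i = k := by omega
        simp [hxk, hz'.symm]

theorem iso_lemma (G : SimpleGraph V) (m : ℕ) (x : ℕ → V) (y : V)
    (hinj : ∀ i j, i ≤ m + 2 → j ≤ m + 2 → x i = x j → i = j) (hy : ∀ i ≤ m + 2, x i ≠ y)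
    (hsurj : ∀ z, z = y ∨ ∃ i ≤ m + 2, x i = z)
    (hadj : ∀ a b, G.Adj a b ↔ ((∃ i < m + 2, s(x i, x (i + 1)) = s(a, b)) ∨
      s(a, b) = s(x (m + 2), y) ∨ s(a, b) = s(y, x (m + 1)))) :
    Nonempty (G ≃g tadpole (m + 4) 3) := by
  let z : ℕ → V := fun j => if j = 0 then y else x (m + 3 - j)
  have hz0 : y = z 0 := rfl
  have hzx : ∀ i ≤ m + 2, x i = z (m + 3 - i) := by
    intro i hi
    simp only [z]
    rw [if_neg (by omega)]
    congr 1
    omega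
  have hzinj : ∀ a b, a < m + 4 → b < m + 4 → z a = z b → a = b := by
    intro a b ha hb h
    simp only [z] at h
    split_ifs at h with h1 h2 h2
    · omega
    · exact absurd h.symm (hy _ (by omega))
    · exact absurd h (hy _ (by omega))
    · have := hinj _ _ (by omega) (by omega) h
      omega
  have hbij : Function.Bijective (fun j : Fin (m + 4) => z j.val) := by
    constructor
    · intro a b h
      exact Fin.ext (hzinj _ _ a.isLt b.isLt h)
    · intro v
      rcases hsurj v with rfl | ⟨i, hi, rfl⟩
      · exact ⟨⟨0, by omega⟩, rfl⟩
      · exact ⟨⟨m + 3 - i, by omega⟩, (hzx i hi).symm⟩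
  have hiff : ∀ a b : Fin (m + 4), G.Adj (z a.val) (z b.val) ↔ (tadpole (m + 4) 3).Adj a b := by
    intro a b
    have ha := a.isLt
    have hb := b.isLt
    rw [tadpole_adj, hadj]
    constructor
    · rintro (⟨i, hi, h⟩ | h | h)
      · rw [hzx i (by omega), hzx (i + 1) (by omega)] at h
        rcases Sym2.eq_iff.mp h with ⟨h1, h2⟩ | ⟨h1, h2⟩
        · have := hzinj _ _ (by omega) (by omega) h1
          have := hzinj _ _ (by omega) (by omega) h2
          omega
        · have := hzinj _ _ (by omega) (by omega) h1
          have := hzinj _ _ (by omega) (by omega) h2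
          omega
      · rw [hzx (m + 2) (by omega), hz0] at h
        rcases Sym2.eq_iff.mp h with ⟨h1, h2⟩ | ⟨h1, h2⟩
        · have := hzinj _ _ (by omega) (by omega) h1
          have := hzinj _ _ (by omega) (by omega) h2
          omega
        · have := hzinj _ _ (by omega) (by omega) h1
          have := hzinj _ _ (by omega) (by omega) h2
          omega
      · rw [hzx (m + 1) (by omega), hz0] at h
        rcases Sym2.eq_iff.mp h with ⟨h1, h2⟩ | ⟨h1, h2⟩
        · have := hzinj _ _ (by omega) (by omega) h1
          have := hzinj _ _ (by omega) (by omega) h2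
          omega
        · have := hzinj _ _ (by omega) (by omega) h1
          have := hzinj _ _ (by omega) (by omega) h2
          omega
    · have main : ∀ a b : ℕ, a < m + 4 → b < m + 4 → (b = a + 1 ∨ (a = 0 ∧ b = 2)) →
          ((∃ i < m + 2, s(x i, x (i + 1)) = s(z a, z b)) ∨
          s(z a, z b) = s(x (m + 2), y) ∨ s(z a, z b) = s(y, x (m + 1))) := by
        intro a b ha hb h
        rcases h with rfl | ⟨rfl, rfl⟩
        · by_cases h0 : a = 0
          · subst h0
            right; left
            rw [hzx (m + 2) (by omega), hz0, Sym2.eq_swap]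
            congr 2
            congr 1
            omega
          · left
            refine ⟨m + 2 - a, by omega, ?_⟩
            rw [hzx _ (by omega), hzx _ (by omega), Sym2.eq_swap]
            have e1 : m + 3 - (m + 2 - a + 1) = a := by omega
            have e2 : m + 3 - (m + 2 - a) = a + 1 := by omega
            rw [e1, e2]
        · right; right
          rw [hzx (m + 1) (by omega), hz0]
          have e1 : m + 3 - (m + 1) = 2 := by omega
          rw [e1]
      rintro (h | h)
      · exact main _ _ ha hb h
      · rw [Sym2.eq_swap (a := z a.val)]
        exact main _ _ hb ha h
  refine ⟨SimpleGraph.Iso.symm ⟨Equiv.ofBijective _ hbij, ?_⟩⟩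
  intro a b
  exact hiff a b

theorem core (G : SimpleGraph V)
    (hconn : G.Connected) (hpend : ∃ x : V, deg G x = 1)
    (m : ℕ) (hedges : G.edgeFinset.card = m + 4)
    (p : ℝ) (hp : 1 < p) (heq : lambda1 G p = lambda1 (tadpole (m + 4) 3) p) :
    Nonempty (G ≃g tadpole (m + 4) 3) := by
  have hp0 : p ≠ 0 := by linarith
  have hp0' : 0 ≤ p := by linarith
  have hd : ∀ x, 0 < deg G x := by
    intro x
    obtain ⟨b, hb⟩ := hpend
    obtain ⟨w⟩ := hconn.preconnected x b
    cases w with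
    | nil => omega
    | @cons _ z _ hz _ =>
      exact Finset.card_pos.mpr ⟨z, by simpa using hz⟩
  have hi : ∃ x, deg G x ≠ 1 := by
    by_contra hcon
    push Not at hcon
    have h1 := pnorm_eq G 1 (fun _ => (1 : ℝ))
    have h2 : ∀ e, nF 1 (fun _ : V => (1 : ℝ)) e = 2 := by
      intro e
      induction e using Sym2.ind with
      | _ a b => simp [nF]; norm_num
    simp only [h2, pnorm, hcon] at h1
    simp [hedges] at h1
    have h3 := hconn.card_vert_le_card_edgeSet_add_one
    rw [Nat.card_eq_fintype_card, Nat.card_eq_fintype_card, ← SimpleGraph.edgeFinset_card,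
      hedges] at h3
    have h4 : (Fintype.card V : ℝ) ≤ (m : ℝ) + 4 + 1 := by exact_mod_cast h3
    have : (0 : ℝ) ≤ m := by positivity
    linarith
  obtain ⟨f, hf0, hf1, ⟨v, hv⟩, hfb, hfl⟩ := exists_min G p hp hd hi
  obtain ⟨d, hd0, hdle, hdstep⟩ := exists_dist G hconn hpend
  have hdv : d v ≠ 0 := by
    intro h
    have := hfb v ((hd0 v).mp h)
    linarith
  obtain ⟨k, hk⟩ := Nat.exists_eq_succ_of_ne_zero hdv
  have hk : d v = k + 1 := hk
  obtain ⟨u, hu, humax⟩ := Finset.exists_max_image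
    (Finset.univ.filter (fun u => G.Adj v u ∧ d u = k)) f (by
      obtain ⟨z, hz⟩ := hdstep v k hk
      exact ⟨z, by simpa using hz⟩)
  simp only [Finset.mem_filter, Finset.mem_univ, true_and] at hu humax
  obtain ⟨hvu, hdu⟩ := hu
  obtain ⟨x', hx'k, hx'd, hx'a⟩ := exists_path G d hdstep k u hdu
  obtain ⟨x, hxk, hxk1, hxd, hxa⟩ : ∃ x : ℕ → V, x k = u ∧ x (k + 1) = v ∧
      (∀ i ≤ k + 1, d (x i) = i) ∧ ∀ i < k + 1, G.Adj (x i) (x (i + 1)) := by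
    refine ⟨fun i => if i ≤ k then x' i else v, by simp [hx'k], by simp, ?_, ?_⟩
    · intro i hi
      by_cases h : i ≤ k
      · simp [h, hx'd i h]
      · obtain rfl : i = k + 1 := by omega
        simp [hk]
    · intro i hi
      by_cases h : i + 1 ≤ k
      · have : i ≤ k := by omega
        simp only [h, this, if_true]
        exact hx'a i (by omega)
      · obtain rfl : i = k := by omega
        simp [hx'k, hvu.symm]
  have hinj : ∀ i j, i ≤ k + 1 → j ≤ k + 1 → x i = x j → i = j := by
    intro i j hi hj h
    rw [← hxd i hi, ← hxd j hj, h]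
  have hfx0 : f (x 0) = 0 := hfb _ ((hd0 _).mp (hxd 0 (by omega)))
  have heF : ∀ e, 0 ≤ eF p f e := by
    intro e
    induction e using Sym2.ind with
    | _ a b => simp only [eF, Sym2.lift_mk]; positivity
  have hpow : ∀ a, f a ^ p ≤ 1 := fun a => Real.rpow_le_one (hf0 a) (hf1 a) hp0'
  have hpow0 : ∀ a, 0 ≤ f a ^ p := fun a => Real.rpow_nonneg (hf0 a) _
  have hnF2 : ∀ e, nF p f e ≤ 2 := by
    intro e
    induction e using Sym2.ind with
    | _ a b =>
      simp only [nF, Sym2.lift_mk, abs_of_nonneg (hf0 _)]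
      linarith [hpow a, hpow b]
  have hEpos : 0 < energy G p f := by
    refine lt_of_le_of_ne (energy_nonneg _ _ _) fun h => ?_
    have h1 := h.symm
    rw [energy_eq, Finset.sum_eq_zero_iff_of_nonneg fun e _ => heF e] at h1
    have h2 : ∀ i ≤ k + 1, f (x i) = 0 := by
      intro i
      induction i with
      | zero => intro _; exact hfx0
      | succ i ih =>
        intro hi
        have h3 := h1 s(x i, x (i + 1)) (by simpa using hxa i (by omega))
        simp only [eF, Sym2.lift_mk] at h3
        rw [Real.rpow_eq_zero (abs_nonneg _) hp0, abs_eq_zero] at h3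
        linarith [ih (by omega)]
    have := h2 (k + 1) le_rfl
    rw [hxk1] at this
    linarith
  have hfne : f ≠ 0 := by
    rintro rfl
    simp at hv
  have hNpos := pnorm_pos G p f hd hfne
  have hApos : 0 < lambda1 G p := by rw [hfl]; exact div_pos hEpos hNpos
  have hAE : lambda1 G p * pnorm G p f = energy G p f := by
    rw [hfl]; exact div_mul_cancel₀ _ hNpos.ne'
  set P := (Finset.range (k + 1)).image (fun i => s(x i, x (i + 1))) with hP
  have hPE : P ⊆ G.edgeFinset := by
    intro e he
    rw [hP, Finset.mem_image] at he
    obtain ⟨i, hi, rfl⟩ := he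
    simpa using hxa i (Finset.mem_range.mp hi)
  have hPinj : Set.InjOn (fun i => s(x i, x (i + 1))) (Finset.range (k + 1) : Set ℕ) := by
    intro i hi j hj h
    have hi : i < k + 1 := by simpa using hi
    have hj : j < k + 1 := by simpa using hj
    rcases Sym2.eq_iff.mp h with ⟨h1, h2⟩ | ⟨h1, h2⟩
    · exact hinj _ _ (by omega) (by omega) h1
    · have := hinj _ _ (by omega) (by omega) h1
      have := hinj _ _ (by omega) (by omega) h2
      omega
  have hPcard : P.card = k + 1 := by
    rw [hP, Finset.card_image_of_injOn hPinj, Finset.card_range]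
  have hRcard : (G.edgeFinset \ P).card + (k + 1) = m + 4 := by
    rw [← hPcard, ← hedges]
    exact Finset.card_sdiff_add_card_eq_card hPE
  have hEsplit : energy G p f = ∑ e ∈ G.edgeFinset \ P, eF p f e +
      ∑ i ∈ Finset.range (k + 1), |f (x i) - f (x (i + 1))| ^ p := by
    rw [energy_eq, ← Finset.sum_sdiff hPE]
    congr 1
    rw [hP, Finset.sum_image hPinj]
    rfl
  have hNsplit : pnorm G p f = ∑ e ∈ G.edgeFinset \ P, nF p f e +
      ∑ i ∈ Finset.range (k + 1), (|f (x i)| ^ p + |f (x (i + 1))| ^ p) := by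
    rw [pnorm_eq, ← Finset.sum_sdiff hPE]
    congr 1
    rw [hP, Finset.sum_image hPinj]
    rfl
  have hRE : 0 ≤ ∑ e ∈ G.edgeFinset \ P, eF p f e := Finset.sum_nonneg fun e _ => heF e
  have hRN : ∑ e ∈ G.edgeFinset \ P, nF p f e ≤ 2 * ((G.edgeFinset \ P).card : ℝ) := by
    have := Finset.sum_le_card_nsmul (G.edgeFinset \ P) (nF p f) 2 fun e _ => hnF2 e
    rw [nsmul_eq_mul] at this
    linarith
  by_cases hkm : k ≤ m
  ·
    exfalso
    obtain ⟨r, rfl⟩ := Nat.exists_eq_add_of_le hkm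
    have hcard : (G.edgeFinset \ P).card = r + 3 := by omega
    have hh : ∀ i ≤ k + 1, f (x (min (k + 1) i)) = f (x i) := by
      intro i hi; rw [min_eq_right hi]
    have hh' : ∀ i, f (x (min (k + 1) (k + 1 + i))) = 1 := by
      intro i; rw [min_eq_left (by omega), hxk1, hv]
    have hsum : ∀ Q : ℝ → ℝ → ℝ, ∑ i ∈ Finset.range (k + r + 1),
        Q (f (x (min (k + 1) i))) (f (x (min (k + 1) (i + 1)))) =
        ∑ i ∈ Finset.range (k + 1), Q (f (x i)) (f (x (i + 1))) + r * Q 1 1 := by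
      intro Q
      have : k + r + 1 = (k + 1) + r := by ring
      rw [this, Finset.sum_range_add]
      congr 1
      · refine Finset.sum_congr rfl fun i hi => ?_
        have := Finset.mem_range.mp hi
        rw [hh i (by omega), hh (i + 1) (by omega)]
      · rw [Finset.sum_congr rfl (g := fun _ => Q 1 1)]
        · simp
        · intro i _
          rw [add_assoc (k + 1), hh', hh']
    refine tadpole_strict (k + r) p hp (fun i => f (x (min (k + 1) i))) (by simp [hfx0]) ?_
      (lambda1 G p) _ _ hApos hAE heq ?_ ?_
    · have := hh' r
      rw [show k + r + 1 = k + 1 + r by ring]; exact this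
    · rw [hsum (fun s t => |s - t| ^ p), hEsplit]
      simp only [sub_self, abs_zero, Real.zero_rpow hp0]
      linarith
    · rw [hsum (fun s t => |s| ^ p + |t| ^ p), hNsplit]
      simp only [abs_one, Real.one_rpow]
      rw [hcard] at hRN
      push_cast at hRN
      linarith
  have hvnp : deg G v ≠ 1 := fun h => hdv ((hd0 v).mpr h)
  obtain ⟨y, hyu, hvy⟩ := exists_other G v u hvnp hvu
  have hdy1 := hdle v y hvy
  have hynp : deg G y ≠ 1 := by
    intro h
    have := (hd0 y).mpr h
    have : k = 0 := by omega
    omega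
  obtain ⟨w, hwv, hyw⟩ := exists_other G y v hynp hvy.symm
  have hdw1 := hdle y w hyw
  have hyx : ∀ i ≤ k + 1, x i ≠ y := by
    intro i hi h
    have h1 := hxd i hi
    rw [h] at h1
    have : i = k ∨ i = k + 1 := by omega
    rcases this with rfl | rfl
    · exact hyu (h.symm.trans hxk)
    · rw [hxk1] at h
      exact hvy.ne h
  have hynP : ∀ z, s(y, z) ∉ P := by
    intro z hz
    rw [hP, Finset.mem_image] at hz
    obtain ⟨i, hi, h⟩ := hz
    have hi := Finset.mem_range.mp hi
    rcases Sym2.eq_iff.mp h with ⟨h1, h2⟩ | ⟨h1, h2⟩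
    · exact hyx i (by omega) h1
    · exact hyx (i + 1) (by omega) h2
  have hne : s(y, v) ≠ s(y, w) := by
    intro h
    rcases Sym2.eq_iff.mp h with ⟨_, h2⟩ | ⟨h1, h2⟩
    · exact hwv h2.symm
    · exact hvy.ne h2
  have hsub : ({s(y, v), s(y, w)} : Finset (Sym2 V)) ⊆ G.edgeFinset \ P := by
    intro e he
    rw [Finset.mem_insert, Finset.mem_singleton] at he
    rw [Finset.mem_sdiff]
    rcases he with rfl | rfl
    · exact ⟨by simpa using hvy.symm, hynP _⟩
    · exact ⟨by simpa using hyw, hynP _⟩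
  have h2card := Finset.card_le_card hsub
  rw [Finset.card_pair hne] at h2card
  obtain rfl : k = m + 1 := by omega
  have hR : G.edgeFinset \ P = {s(y, v), s(y, w)} := by
    symm
    apply Finset.eq_of_subset_of_card_le hsub
    rw [Finset.card_pair hne]
    omega
  have hadj : ∀ a b, G.Adj a b ↔ s(a, b) ∈ P ∨ s(a, b) = s(y, v) ∨ s(a, b) = s(y, w) := by
    intro a b
    have h1 : s(a, b) ∈ G.edgeFinset ↔ s(a, b) ∈ P ∨ s(a, b) ∈ G.edgeFinset \ P := by
      rw [Finset.mem_sdiff]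
      constructor
      · intro h
        by_cases h' : s(a, b) ∈ P
        · exact Or.inl h'
        · exact Or.inr ⟨h, h'⟩
      · rintro (h | h)
        · exact hPE h
        · exact h.1
    rw [hR] at h1
    simpa using h1
  rw [hR, Finset.sum_pair hne, Finset.sum_range_succ, hxk1, hxk, hv] at hEsplit hNsplit
  simp only [eF, nF, Sym2.lift_mk, abs_of_nonneg (hf0 _), hv, abs_one, Real.one_rpow]
    at hEsplit hNsplit
  by_cases hfu : f u = 1
  · exfalso
    refine tadpole_strict m p hp (fun i => f (x i)) hfx0 (by simp only [hxk, hfu])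
      (lambda1 G p) _ _ hApos hAE heq ?_ ?_
    · rw [hEsplit]
      have : 0 ≤ |f y - 1| ^ p := by positivity
      have : 0 ≤ |f y - f w| ^ p := by positivity
      have : 0 ≤ |f u - 1| ^ p := by positivity
      linarith
    · rw [hNsplit]
      simp only [abs_of_nonneg (hf0 _)]
      linarith [hpow y, hpow w, hpow u]
  have hfu1 : f u < 1 := lt_of_le_of_ne (hf1 u) hfu
  by_cases hwu : w = u
  ·
    refine iso_lemma G m x y hinj hyx ?_ ?_
    · intro z
      obtain ⟨z', hz'⟩ := Finset.card_pos.mp (hd z)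
      have hz' : G.Adj z z' := by simpa using hz'
      rcases (hadj z z').mp hz' with h | h | h
      · rw [hP, Finset.mem_image] at h
        obtain ⟨i, hi, h⟩ := h
        have hi := Finset.mem_range.mp hi
        rcases Sym2.eq_iff.mp h with ⟨h1, h2⟩ | ⟨h1, h2⟩
        · exact Or.inr ⟨i, by omega, h1⟩
        · exact Or.inr ⟨i + 1, by omega, h2⟩
      · rcases Sym2.eq_iff.mp h with ⟨h1, h2⟩ | ⟨h1, h2⟩
        · exact Or.inl h1
        · exact Or.inr ⟨m + 2, le_rfl, hxk1.trans h1.symm⟩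
      · rcases Sym2.eq_iff.mp h with ⟨h1, h2⟩ | ⟨h1, h2⟩
        · exact Or.inl h1
        · exact Or.inr ⟨m + 1, by omega, hxk.trans (hwu.symm.trans h1.symm)⟩
    · intro a b
      rw [hadj, hxk, hxk1, hwu, Sym2.eq_swap (a := v), hP, Finset.mem_image]
      simp only [Finset.mem_range]
  exfalso
  have hdy : d y = m + 1 := by
    by_cases hwx : ∃ i ≤ m + 1 + 1, x i = w
    · obtain ⟨i, hi, rfl⟩ := hwx
      have h1 := hxd i hi
      have h2 : i ≠ m + 1 := by rintro rfl; exact hwu hxk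
      have h3 : i ≠ m + 1 + 1 := by rintro rfl; exact hwv hxk1
      omega
    · push Not at hwx
      have hw1 : deg G w = 1 := by
        by_contra hw
        obtain ⟨z, hzy, hwz⟩ := exists_other G w y hw hyw.symm
        rcases (hadj w z).mp hwz with h | h | h
        · rw [hP, Finset.mem_image] at h
          obtain ⟨i, hi, h⟩ := h
          have hi := Finset.mem_range.mp hi
          rcases Sym2.eq_iff.mp h with ⟨h1, h2⟩ | ⟨h1, h2⟩
          · exact hwx i (by omega) h1
          · exact hwx (i + 1) (by omega) h2
        · rcases Sym2.eq_iff.mp h with ⟨h1, h2⟩ | ⟨h1, h2⟩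
          · exact hyw.ne h1.symm
          · exact hwv h1
        · rcases Sym2.eq_iff.mp h with ⟨h1, h2⟩ | ⟨h1, h2⟩
          · exact hyw.ne h1.symm
          · exact hzy h2
      have := (hd0 w).mpr hw1
      omega
  have hfy : f y ≤ f u := humax y ⟨hvy, hdy⟩
  have key := tadpole_le m p (fun i => f (x i)) 1 hfx0 one_pos
  rw [← heq] at key
  simp only [hxk, sub_self, abs_zero, Real.zero_rpow hp0, abs_one, Real.one_rpow,
    abs_of_nonneg (hf0 _)] at key
  have e1 : |1 - f u| ^ p ≤ |f y - 1| ^ p := by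
    apply Real.rpow_le_rpow (abs_nonneg _) _ hp0'
    rw [abs_of_nonneg (by linarith), abs_sub_comm, abs_of_nonneg (by linarith)]
    linarith
  have e2 : |f u - 1| ^ p = |1 - f u| ^ p := by rw [abs_sub_comm]
  have e3 : 0 ≤ |f y - f w| ^ p := by positivity
  have e4 : f y ^ p ≤ f u ^ p := Real.rpow_le_rpow (hf0 y) hfy hp0'
  have e5 : f u ^ p < 1 := Real.rpow_lt_one (hf0 u) hfu1 (by linarith)
  have e6 := hpow w
  have hlt : lambda1 G p * pnorm G p f < lambda1 G p * (2 * (1 + f u ^ p) + (1 + 1) +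
      ∑ i ∈ Finset.range (m + 1), (f (x i) ^ p + f (x (i + 1)) ^ p)) := by
    apply mul_lt_mul_of_pos_left _ hApos
    rw [hNsplit]
    linarith
  linarith

end aux2
/-- Rigidity in the Faber–Krahn inequality for the normalized `p`-Laplacian: for a connected
finite simple graph `G` with at least one pendant vertex and `n ≥ 4` edges, and `p > 1`,
`λ_{1,p}(G) = λ_{1,p}(T_{n,3})` if and only if `G` is isomorphic to `T_{n,3}`. -/
theorem faber_krahn_rigidity {V : Type*} [Fintype V] (G : SimpleGraph V)
    (hconn : G.Connected) (hpend : ∃ x : V, deg G x = 1)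
    (n : ℕ) (hn : 4 ≤ n) (hedges : G.edgeFinset.card = n)
    (p : ℝ) (hp : 1 < p) :
    lambda1 G p = lambda1 (tadpole n 3) p ↔ Nonempty (G ≃g tadpole n 3) := by
  obtain ⟨m, rfl⟩ := Nat.exists_eq_add_of_le' hn
  constructor
  · intro h
    exact core G hconn hpend m hedges p hp h
  · rintro ⟨φ⟩
    exact lambda1_iso G _ p φ
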